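/- Let α > 0 and φ_α as above with φ̂_α(ξ) = C(1+|ξ|)^{-d/2}(log(2+|ξ|))^{-(1+α)/2}. For the high-frequency truncation, there exist constants c₁, c₂ > 0 such that for all sufficiently small τ̃ > 0: c₁(-log τ̃)^{-α/2} ≤ ‖φ_α - P(τ̃)φ_α‖_{L²(ℝ^d)} ≤ c₂(-log τ̃)^{-α/2}, where P(τ̃) is the smooth Fourier cutoff to frequencies |ξ| ≲ τ̃^{-1/2}. -/

import Mathlib

open MeasureTheory FourierTransform Metric

open scoped SchwartzMap in
/-- Plancherel's identity for an integrable function whose Fourier transform is in `L²`. -/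
theorem eLpNorm_fourier_eq_of_memLp {V : Type*} [NormedAddCommGroup V] [InnerProductSpace ℝ V]
    [FiniteDimensional ℝ V] [MeasurableSpace V] [BorelSpace V] {f : V → ℂ}
    (hf : Integrable f) (hF : MemLp (𝓕 f) 2 volume) :
    eLpNorm (𝓕 f) 2 volume = eLpNorm f 2 volume := by
  set G : Lp ℂ 2 (volume : Measure V) := hF.toLp _ with hG
  set H : Lp ℂ 2 (volume : Measure V) := 𝓕⁻ G with hH
  have hHG : 𝓕 H = G := FourierTransform.fourier_fourierInv_eq G
  have key (ψ : 𝓢(V, ℂ)) : ∫ x, (𝓕 ψ) x • f x = ∫ x, (𝓕 ψ) x • H x := by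
    have h1 : ∫ x, (𝓕 (ψ : V → ℂ)) x • f x = ∫ x, ψ x • 𝓕 f x := by
      simpa using! (VectorFourier.integral_fourierIntegral_smul_eq_flip (L := innerₗ V)
        Real.continuous_fourierChar continuous_inner ψ.integrable hf)
    have h2 := congrArg (fun T => T ψ) (Lp.fourier_toTemperedDistribution_eq H)
    simp only [TemperedDistribution.fourier_apply, Lp.toTemperedDistribution_apply, hHG] at h2
    rw [h2, SchwartzMap.fourier_coe, h1]
    refine integral_congr_ae ?_
    filter_upwards [hF.coeFn_toLp] with x hx
    rw [hG, hx]
  have hae : ∀ᵐ x, f x = H x := by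
    refine ae_eq_of_integral_contDiff_smul_eq hf.locallyIntegrable
      ((Lp.memLp H).locallyIntegrable (by norm_num)) fun g hg hgs => ?_
    have hgc : HasCompactSupport fun x => (g x : ℂ) := hgs.comp_left Complex.ofReal_zero
    have hgd : ContDiff ℝ (⊤ : ℕ∞) fun x => (g x : ℂ) := Complex.ofRealCLM.contDiff.comp hg
    have h := key (𝓕⁻ (hgc.toSchwartzMap hgd))
    rw [FourierTransform.fourier_fourierInv_eq] at h
    simpa using h
  calc eLpNorm (𝓕 f) 2 volume = ‖G‖ₑ := by
        rw [Lp.enorm_def]; exact eLpNorm_congr_ae hF.coeFn_toLp.symm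
    _ = ‖H‖ₑ := by rw [← hHG, ← ofReal_norm, Lp.norm_fourier_eq, ofReal_norm]
    _ = eLpNorm f 2 volume := by
        rw [Lp.enorm_def]; exact (eLpNorm_congr_ae hae).symm

open Set Filter Topology in
/-- The primitive of `y⁻¹ (log y)^(-(1 + α))`, integrated over `(R, ∞)`. -/
theorem integral_Ioi_inv_mul_log_rpow {α R : ℝ} (hα : 0 < α) (hR : 1 < R) :
    IntegrableOn (fun y => y⁻¹ * Real.log y ^ (-(1 + α))) (Ioi R) ∧
      ∫ y in Ioi R, y⁻¹ * Real.log y ^ (-(1 + α)) = Real.log R ^ (-α) / α := by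
  have hd : ∀ y ∈ Ici R, HasDerivAt (fun y => -(Real.log y ^ (-α) / α))
      (y⁻¹ * Real.log y ^ (-(1 + α))) y := by
    intro y hy
    have hy1 : 1 < y := hR.trans_le hy
    have h := ((((Real.hasDerivAt_log (by positivity : y ≠ 0)).rpow_const (p := -α)
      (Or.inl (Real.log_pos hy1).ne'))).div_const α).neg
    convert! h using 1
    rw [show -α - 1 = -(1 + α) by ring]
    field_simp
  have hpos : ∀ y ∈ Ioi R, 0 ≤ y⁻¹ * Real.log y ^ (-(1 + α)) := by
    intro y hy
    have hy1 : 1 < y := hR.trans hy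
    have := Real.log_pos hy1
    positivity
  have hlim : Tendsto (fun y => -(Real.log y ^ (-α) / α)) atTop (𝓝 0) := by
    simpa using ((((tendsto_rpow_neg_atTop hα).comp Real.tendsto_log_atTop).div_const α).neg)
  refine ⟨integrableOn_Ioi_deriv_of_nonneg' hd hpos hlim, ?_⟩
  rw [integral_Ioi_of_hasDerivAt_of_nonneg' hd hpos hlim]
  ring

/-- The radial profile `r^(-d/2) (log r)^(-(1 + α)/2)`, cut off to `r ≥ R`. -/
noncomputable def logTail (d : ℕ) (α R : ℝ) : ℝ → ℝ :=
  (Set.Ici R).indicator fun r => r ^ (-(d : ℝ) / 2) * Real.log r ^ (-(1 + α) / 2)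

theorem measurable_logTail (d : ℕ) (α R : ℝ) : Measurable (logTail d α R) :=
  Measurable.indicator (by fun_prop) measurableSet_Ici

open Set in
theorem pow_mul_logTail_sq {d : ℕ} (hd : 1 ≤ d) (α : ℝ) {R : ℝ} (hR : 1 < R) (y : ℝ) :
    y ^ (d - 1) • logTail d α R y ^ 2 =
      (Ici R).indicator (fun y => y⁻¹ * Real.log y ^ (-(1 + α))) y := by
  by_cases hy : R ≤ y
  · have hy1 : 1 < y := hR.trans_le hy
    have hy0 : 0 < y := by positivity
    have hl := Real.log_pos hy1
    rw [logTail, indicator_of_mem (show y ∈ Ici R from hy),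
      indicator_of_mem (show y ∈ Ici R from hy), mul_pow, ← Real.rpow_mul_natCast hy0.le,
      ← Real.rpow_mul_natCast hl.le, smul_eq_mul, ← mul_assoc, ← Real.rpow_natCast y (d - 1),
      ← Real.rpow_add hy0, ← Real.rpow_neg_one y]
    congr 2
    · push_cast [Nat.cast_sub hd]; ring
    · push_cast; ring
  · simp [logTail, hy]

open Set in
/-- The exact `L²` size of the cut-off radial profile. -/
theorem eLpNorm_logTail {d : ℕ} (hd : 1 ≤ d) {α : ℝ} (hα : 0 < α) :
    ∃ K : ℝ, 0 < K ∧ ∀ R : ℝ, 1 < R →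
      MemLp (fun x : EuclideanSpace ℝ (Fin d) => logTail d α R ‖x‖) 2 ∧
      eLpNorm (fun x : EuclideanSpace ℝ (Fin d) => logTail d α R ‖x‖) 2 volume =
        ENNReal.ofReal (K * Real.log R ^ (-α / 2)) := by
  set B := (volume : Measure (EuclideanSpace ℝ (Fin d))).real (ball 0 1)
  have hB : 0 < B := ENNReal.toReal_pos (measure_ball_pos _ _ one_pos).ne' measure_ball_lt_top.ne
  have hd0 : (0 : ℝ) < d := by exact_mod_cast hd
  have : Nonempty (Fin d) := ⟨⟨0, hd⟩⟩
  refine ⟨(d * B / α) ^ (1 / 2 : ℝ), by positivity, fun R hR => ?_⟩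
  obtain ⟨hint, hval⟩ := integral_Ioi_inv_mul_log_rpow hα hR
  have hsub : Ici R ⊆ Ioi 0 := fun y hy => (one_pos.trans hR).trans_le hy
  have hmem : MemLp (fun x : EuclideanSpace ℝ (Fin d) => logTail d α R ‖x‖) 2 := by
    have hmeas : Measurable fun x : EuclideanSpace ℝ (Fin d) => logTail d α R ‖x‖ :=
      (measurable_logTail d α R).comp measurable_norm
    refine (memLp_two_iff_integrable_sq hmeas.aestronglyMeasurable).2 ?_
    rw [integrable_fun_norm_addHaar volume (f := fun r => logTail d α R r ^ 2)]
    simp only [finrank_euclideanSpace, Fintype.card_fin, pow_mul_logTail_sq hd α hR]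
    exact (((integrableOn_Ici_iff_integrableOn_Ioi enorm_ne_top).2 hint).integrable_indicator
      measurableSet_Ici).integrableOn
  refine ⟨hmem, ?_⟩
  have hI : ∫ x : EuclideanSpace ℝ (Fin d), logTail d α R ‖x‖ ^ 2 =
      d * B / α * Real.log R ^ (-α) := by
    rw [integral_fun_norm_addHaar volume (fun r => logTail d α R r ^ 2)]
    simp only [finrank_euclideanSpace, Fintype.card_fin, pow_mul_logTail_sq hd α hR]
    rw [setIntegral_indicator measurableSet_Ici, inter_eq_right.2 hsub,
      integral_Ici_eq_integral_Ioi, hval, nsmul_eq_mul, smul_eq_mul]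
    ring
  have hl := Real.log_pos hR
  rw [hmem.eLpNorm_eq_integral_rpow_norm (by simp) (by simp)]
  simp only [ENNReal.toReal_ofNat, Real.rpow_ofNat, Real.norm_eq_abs, sq_abs]
  rw [hI, Real.mul_rpow (by positivity) (by positivity), ← Real.rpow_mul hl.le]
  congr 3
  ring

/-- An integral defining a nonzero value of the Fourier transform converges. -/
theorem integrable_of_fourier_ne_zero {V : Type*} [NormedAddCommGroup V] [InnerProductSpace ℝ V]
    [FiniteDimensional ℝ V] [MeasurableSpace V] [BorelSpace V] {f : V → ℂ} {w : V}
    (h : 𝓕 f w ≠ 0) : Integrable f := by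
  rw [Real.fourier_eq] at h
  exact (Real.fourierIntegral_convergent_iff w).1 (not_imp_comm.1 integral_undef h)

/-- Two-sided logarithmic bound for the high-frequency tail of `φ_α`:
`c₁(-log τ̃)^{-α/2} ≤ ‖φ_α - P(τ̃)φ_α‖_{L²} ≤ c₂(-log τ̃)^{-α/2}` for small `τ̃`. -/
theorem stmt_16 (d : ℕ) (hd : 1 ≤ d) (α : ℝ) (hα : 0 < α) (C : ℝ) (hC : 0 < C)
    (χ : EuclideanSpace ℝ (Fin d) → ℂ)
    (hχ_smooth : ContDiff ℝ (⊤ : ℕ∞) χ)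
    (hχ_supp : Function.support χ ⊆ ball 0 2)
    (hχ_one : ∀ ξ ∈ ball (0 : EuclideanSpace ℝ (Fin d)) 1, χ ξ = 1)
    (φ : EuclideanSpace ℝ (Fin d) → ℂ)
    (hφ : ∀ ξ, 𝓕 φ ξ =
      ((C * (1 + ‖ξ‖) ^ (-(d : ℝ) / 2) * Real.log (2 + ‖ξ‖) ^ (-(1 + α) / 2) : ℝ) : ℂ))
    (Pφ : ℝ → EuclideanSpace ℝ (Fin d) → ℂ)
    (hPφ : ∀ (τ : ℝ) (ξ : EuclideanSpace ℝ (Fin d)),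
      𝓕 (Pφ τ) ξ = χ (Real.sqrt τ • ξ) * 𝓕 φ ξ) :
    ∃ c₁ c₂ τ₀ : ℝ, 0 < c₁ ∧ 0 < c₂ ∧ 0 < τ₀ ∧
      ∀ τ : ℝ, 0 < τ → τ < τ₀ →
        ENNReal.ofReal (c₁ * (-Real.log τ) ^ (-α / 2))
            ≤ eLpNorm (φ - Pφ τ) 2 volume ∧
          eLpNorm (φ - Pφ τ) 2 volume
            ≤ ENNReal.ofReal (c₂ * (-Real.log τ) ^ (-α / 2)) := by
  obtain ⟨K, hK, hKR⟩ := eLpNorm_logTail hd hα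
  obtain ⟨M, hM⟩ : ∃ M, ∀ ξ, ‖1 - χ ξ‖ ≤ M := by
    have hcs : HasCompactSupport χ :=
      HasCompactSupport.of_support_subset_isCompact (isCompact_closedBall 0 2)
        (hχ_supp.trans ball_subset_closedBall)
    obtain ⟨M, hM⟩ := hcs.exists_bound_of_continuous hχ_smooth.continuous
    exact ⟨1 + M, fun ξ => (norm_sub_le _ _).trans (by simpa using hM ξ)⟩
  have hM1 : 0 < M + 1 := by linarith [(norm_nonneg _).trans (hM 0)]
  have hpos (ξ : EuclideanSpace ℝ (Fin d)) :
      0 < C * (1 + ‖ξ‖) ^ (-(d : ℝ) / 2) * Real.log (2 + ‖ξ‖) ^ (-(1 + α) / 2) := by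
    have := norm_nonneg ξ
    have := Real.log_pos (show 1 < 2 + ‖ξ‖ by linarith)
    positivity
  have hφ0 : 𝓕 φ 0 ≠ 0 := by
    rw [hφ]
    exact_mod_cast (hpos 0).ne'
  have hφi : Integrable φ := integrable_of_fourier_ne_zero hφ0
  have hPi (τ : ℝ) : Integrable (Pφ τ) := by
    refine integrable_of_fourier_ne_zero (w := 0) ?_
    rw [hPφ, smul_zero, hχ_one 0 (by simp), one_mul]
    exact hφ0
  have hF (τ : ℝ) (ξ) : 𝓕 (φ - Pφ τ) ξ = (1 - χ (√τ • ξ)) * 𝓕 φ ξ := by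
    rw [sub_mul, one_mul, ← hPφ]
    simp only [Real.fourier_eq, Pi.sub_apply, smul_sub]
    exact integral_sub ((Real.fourierIntegral_convergent_iff ξ).2 hφi)
      ((Real.fourierIntegral_convergent_iff ξ).2 (hPi τ))
  have hFn (τ : ℝ) (ξ) : ‖𝓕 (φ - Pφ τ) ξ‖ = ‖1 - χ (√τ • ξ)‖ *
      (C * (1 + ‖ξ‖) ^ (-(d : ℝ) / 2) * Real.log (2 + ‖ξ‖) ^ (-(1 + α) / 2)) := by
    rw [hF, norm_mul, hφ, Complex.norm_real, Real.norm_of_nonneg (hpos ξ).le]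
  set A : ℝ := 2 ^ ((d : ℝ) / 2) * 2 ^ ((1 + α) / 2) / C with hA
  have hA0 : 0 < A := by positivity
  refine ⟨K / A, (M + 1) * C * (K * 2 ^ (α / 2)), 1 / 4, by positivity, by positivity,
    by norm_num, fun τ hτ hτ4 => ?_⟩
  have hs0 : 0 < √τ := Real.sqrt_pos.2 hτ
  have hs : √τ < 1 / 2 := by
    rw [Real.sqrt_lt' (by norm_num)]; linarith
  set R : ℝ := (√τ)⁻¹ with hR
  have hR2 : 2 < R := by
    rw [hR, lt_inv_comm₀ two_pos hs0]; linarith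
  have hsR : √τ * R = 1 := mul_inv_cancel₀ hs0.ne'
  have hlogR : Real.log R = -Real.log τ / 2 := by
    rw [hR, Real.log_inv, Real.log_sqrt hτ.le]; ring
  have hlogR0 : 0 < Real.log R := Real.log_pos (by linarith)
  have hnorm (ξ : EuclideanSpace ℝ (Fin d)) : ‖√τ • ξ‖ = √τ * ‖ξ‖ := by
    rw [norm_smul, Real.norm_of_nonneg hs0.le]
  have hupper (ξ) : ‖𝓕 (φ - Pφ τ) ξ‖ ≤ (M + 1) * C * ‖logTail d α R ‖ξ‖‖ := by
    by_cases hξ : R ≤ ‖ξ‖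
    · have hl := Real.log_pos (show 1 < ‖ξ‖ by linarith)
      rw [hFn, logTail, Set.indicator_of_mem (show ‖ξ‖ ∈ Set.Ici R from hξ),
        Real.norm_of_nonneg (by positivity), mul_assoc (M + 1), mul_assoc C]
      have hl2 := Real.log_pos (show 1 < 2 + ‖ξ‖ by linarith)
      gcongr ?_ * (C * (?_ * ?_))
      · linarith [hM (√τ • ξ)]
      · refine Real.rpow_le_rpow_of_nonpos (by linarith) (by linarith) ?_
        have : (0 : ℝ) ≤ d := by positivity
        linarith
      · exact Real.rpow_le_rpow_of_nonpos hl (Real.log_le_log (by linarith) (by linarith))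
          (by linarith)
    · have hlt : √τ * ‖ξ‖ < 1 := by
        rw [← hsR]; exact mul_lt_mul_of_pos_left (not_le.1 hξ) hs0
      rw [hFn, hχ_one _ (by rwa [mem_ball_zero_iff, hnorm])]
      simp only [sub_self, norm_zero, zero_mul]
      positivity
  have hlower (ξ) : ‖logTail d α (2 * R) ‖ξ‖‖ ≤ A * ‖𝓕 (φ - Pφ τ) ξ‖ := by
    by_cases hξ : 2 * R ≤ ‖ξ‖
    · have hl := Real.log_pos (show 1 < ‖ξ‖ by linarith)
      have hl2 := Real.log_pos (show 1 < 2 + ‖ξ‖ by linarith)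
      have hχ0 : χ (√τ • ξ) = 0 := by
        by_contra h
        have h2 := hχ_supp h
        rw [mem_ball_zero_iff, hnorm] at h2
        nlinarith
      have hlog : Real.log (2 + ‖ξ‖) ≤ 2 * Real.log ‖ξ‖ := by
        rw [← Real.log_rpow (by linarith) 2]
        refine Real.log_le_log (by linarith) ?_
        rw [Real.rpow_two]
        nlinarith
      have h1 : ‖ξ‖ ^ (-(d : ℝ) / 2) ≤ 2 ^ ((d : ℝ) / 2) * (1 + ‖ξ‖) ^ (-(d : ℝ) / 2) := by
        have h : (2 * ‖ξ‖) ^ (-(d : ℝ) / 2) ≤ (1 + ‖ξ‖) ^ (-(d : ℝ) / 2) := by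
          refine Real.rpow_le_rpow_of_nonpos (by linarith) (by linarith) ?_
          have : (0 : ℝ) ≤ d := by positivity
          linarith
        rw [Real.mul_rpow two_pos.le (norm_nonneg ξ)] at h
        calc ‖ξ‖ ^ (-(d : ℝ) / 2)
            = 2 ^ ((d : ℝ) / 2) * (2 ^ (-(d : ℝ) / 2) * ‖ξ‖ ^ (-(d : ℝ) / 2)) := by
              rw [← mul_assoc, ← Real.rpow_add two_pos, neg_div, add_neg_cancel, Real.rpow_zero,
                one_mul]
          _ ≤ _ := by gcongr
      have h2 : Real.log ‖ξ‖ ^ (-(1 + α) / 2) ≤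
          2 ^ ((1 + α) / 2) * Real.log (2 + ‖ξ‖) ^ (-(1 + α) / 2) := by
        have h : (2 * Real.log ‖ξ‖) ^ (-(1 + α) / 2) ≤ Real.log (2 + ‖ξ‖) ^ (-(1 + α) / 2) :=
          Real.rpow_le_rpow_of_nonpos hl2 hlog (by linarith)
        rw [Real.mul_rpow two_pos.le hl.le] at h
        calc Real.log ‖ξ‖ ^ (-(1 + α) / 2)
            = 2 ^ ((1 + α) / 2) * (2 ^ (-(1 + α) / 2) * Real.log ‖ξ‖ ^ (-(1 + α) / 2)) := by
              rw [← mul_assoc, ← Real.rpow_add two_pos, neg_div, add_neg_cancel, Real.rpow_zero,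
                one_mul]
          _ ≤ _ := by gcongr
      rw [hFn, hχ0, sub_zero, norm_one, one_mul, logTail,
        Set.indicator_of_mem (show ‖ξ‖ ∈ Set.Ici (2 * R) from hξ),
        Real.norm_of_nonneg (by positivity)]
      refine (mul_le_mul h1 h2 (by positivity) (by positivity)).trans_eq ?_
      rw [hA]
      field_simp
    · rw [logTail, Set.indicator_of_notMem (show ‖ξ‖ ∉ Set.Ici (2 * R) from hξ), norm_zero]
      positivity
  obtain ⟨hmR, heR⟩ := hKR R (by linarith)
  obtain ⟨-, he2R⟩ := hKR (2 * R) (by linarith)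
  have hgi : Integrable (φ - Pφ τ) := hφi.sub (hPi τ)
  have hmeas : AEStronglyMeasurable (𝓕 (φ - Pφ τ)) volume :=
    (VectorFourier.fourierIntegral_continuous Real.continuous_fourierChar
      (L := innerₗ _) continuous_inner hgi).aestronglyMeasurable
  rw [← eLpNorm_fourier_eq_of_memLp hgi (hmR.of_le_mul hmeas (.of_forall hupper))]
  constructor
  · have h := eLpNorm_le_mul_eLpNorm_of_ae_le_mul (.of_forall hlower) 2 (μ := volume)
    rw [he2R] at h
    have hlog2 : Real.log (2 * R) ≤ -Real.log τ := by
      rw [Real.log_mul two_ne_zero (by positivity)]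
      linarith [Real.log_le_log two_pos hR2.le]
    have hlog0 : 0 < Real.log (2 * R) := Real.log_pos (by linarith)
    calc ENNReal.ofReal (K / A * (-Real.log τ) ^ (-α / 2))
        ≤ ENNReal.ofReal (A⁻¹ * (K * Real.log (2 * R) ^ (-α / 2))) := by
          refine ENNReal.ofReal_le_ofReal ?_
          rw [div_eq_inv_mul, mul_assoc]
          gcongr A⁻¹ * (K * ?_)
          exact Real.rpow_le_rpow_of_nonpos hlog0 hlog2 (by linarith)
      _ ≤ ENNReal.ofReal A⁻¹ * (ENNReal.ofReal A * eLpNorm (𝓕 (φ - Pφ τ)) 2 volume) := by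
          rw [ENNReal.ofReal_mul (by positivity)]
          gcongr
      _ = eLpNorm (𝓕 (φ - Pφ τ)) 2 volume := by
          rw [← mul_assoc, ← ENNReal.ofReal_mul (by positivity), inv_mul_cancel₀ hA0.ne',
            ENNReal.ofReal_one, one_mul]
  · refine (eLpNorm_le_mul_eLpNorm_of_ae_le_mul (.of_forall hupper) 2).trans_eq ?_
    rw [heR, ← ENNReal.ofReal_mul (by positivity), hlogR,
      Real.div_rpow (by linarith) two_pos.le, neg_div 2 α, Real.rpow_neg two_pos.le, div_inv_eq_mul]
    congr 1
    ring
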